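/- arXiv:1507.02272 — 4 statements merged into one kernel-verified Lean document; each statement's English description precedes it below -/
import Mathlib

section
/- For every real a > 0 there exist reals β > 0 and c > 0 and an integer n₀ such that for every integer n ≥ n₀ the following holds: if each of n balls independently chooses a bin uniformly at random from {1,…,⌈n/ln n⌉} and, independently, a label uniformly at random from {1,…,⌈n^β⌉}, then with probability at least 1 − n^{−a} both (i) every bin contains at most c·ln n balls, and (ii) no two distinct balls have both the same bin and the same label. -/
open scoped Classical

/-- Exponential moment of the number of coordinates satisfying `p`, in counting form. -/
lemma sum_exp_card_filter {α : Type*} [Fintype α] (n : ℕ) (p : α → Prop) [DecidablePred p] :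
    ∑ X : Fin n → α, Real.exp ((Finset.univ.filter (fun i => p (X i))).card : ℝ) =
      (∑ x : α, if p x then Real.exp 1 else 1) ^ n := by
  rw [Fintype.sum_pow]
  refine Finset.sum_congr rfl fun X _ => ?_
  rw [Finset.prod_ite, Finset.prod_const, Finset.prod_const_one, mul_one, ← Real.exp_nat_mul,
    mul_one]

lemma sum_ite_fst_eq {m l : ℕ} (b : Fin m) (t : ℝ) :
    ∑ x : Fin m × Fin l, (if x.1 = b then t else 1) = l * (m + (t - 1)) := by
  have h (x : Fin m) : (if x = b then t else 1) = 1 + (if x = b then t - 1 else 0) := by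
    split_ifs <;> ring
  rw [Fintype.sum_prod_type]
  simp only [Finset.sum_const, Finset.card_univ, Fintype.card_fin, nsmul_eq_mul,
    ← Finset.mul_sum, h, Finset.sum_add_distrib, Finset.sum_ite_eq', Finset.mem_univ, if_true,
    mul_one]

/-- Chernoff bound for the load of a single bin, in counting form. -/
lemma card_load_gt_le {n m l : ℕ} {s : ℝ} (hm : 0 < m) (hnm : (n : ℝ) ≤ m * s)
    (b : Fin m) (c : ℝ) :
    ((Finset.univ.filter (fun X : Fin n → Fin m × Fin l =>
      c * s < ((Finset.univ.filter (fun i => (X i).1 = b)).card : ℝ))).card : ℝ) ≤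
      Real.exp ((2 - c) * s) * ((m : ℝ) * l) ^ n := by
  have hm' : (0 : ℝ) < m := by exact_mod_cast hm
  have hs : 0 ≤ s := by
    by_contra! h
    have : (0 : ℝ) ≤ n := n.cast_nonneg
    nlinarith
  set S := Finset.univ.filter (fun X : Fin n → Fin m × Fin l =>
      c * s < ((Finset.univ.filter (fun i => (X i).1 = b)).card : ℝ)) with hS
  have markov : (S.card : ℝ) * Real.exp (c * s) ≤
      ∑ X : Fin n → Fin m × Fin l,
        Real.exp ((Finset.univ.filter (fun i => (X i).1 = b)).card : ℝ) := by
    rw [← nsmul_eq_mul]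
    refine (Finset.card_nsmul_le_sum S _ _ fun X hX => ?_).trans
      (Finset.sum_le_sum_of_subset_of_nonneg (Finset.subset_univ S) fun _ _ _ =>
        (Real.exp_pos _).le)
    exact Real.exp_le_exp.2 (Finset.mem_filter.1 hX).2.le
  have moment : ∑ X : Fin n → Fin m × Fin l,
        Real.exp ((Finset.univ.filter (fun i => (X i).1 = b)).card : ℝ) ≤
      Real.exp (2 * s) * ((m : ℝ) * l) ^ n := by
    have key := sum_exp_card_filter n (fun x : Fin m × Fin l => x.1 = b)
    have hsum := sum_ite_fst_eq (l := l) b (Real.exp 1)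
    have he : Real.exp 1 - 1 ≤ 2 := by linarith [Real.exp_one_lt_d9]
    have hbase : (l : ℝ) * (m + (Real.exp 1 - 1)) ≤ Real.exp (2 / m) * (m * l) := by
      have h1 : 2 / (m : ℝ) + 1 ≤ Real.exp (2 / m) := Real.add_one_le_exp _
      calc (l : ℝ) * (m + (Real.exp 1 - 1)) ≤ l * (m + 2) := by gcongr
        _ = (2 / m + 1) * (m * l) := by field_simp; ring
        _ ≤ _ := by gcongr
    calc _ = ((l : ℝ) * (m + (Real.exp 1 - 1))) ^ n := by
            rw [← hsum, ← key]
      _ ≤ (Real.exp (2 / m) * (m * l)) ^ n := by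
            have : 0 ≤ Real.exp 1 - 1 := by linarith [Real.add_one_le_exp (1 : ℝ)]
            gcongr
      _ = Real.exp (n * (2 / m)) * ((m : ℝ) * l) ^ n := by
            rw [mul_pow, ← Real.exp_nat_mul]
      _ ≤ _ := by
            have : (n : ℝ) * (2 / m) ≤ 2 * s := by
              rw [mul_div_assoc', div_le_iff₀ hm']
              linarith
            gcongr
  refine le_of_mul_le_mul_right ?_ (Real.exp_pos (c * s))
  calc _ ≤ _ := markov.trans moment
    _ = _ := by
      rw [mul_right_comm, ← Real.exp_add]
      ring_nf

/-- Birthday bound, in counting form. -/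
lemma card_not_injective_le {α : Type*} [Fintype α] [DecidableEq α] {n : ℕ}
    (hn : n ≤ Fintype.card α) :
    ((Finset.univ.filter (fun X : Fin n → α => ¬ Function.Injective X)).card : ℝ) ≤
      (n : ℝ) ^ 2 / Fintype.card α * (Fintype.card α : ℝ) ^ n := by
  rcases Nat.eq_zero_or_pos n with rfl | hpos
  · simp [Function.injective_of_subsingleton]
  set K := Fintype.card α
  have hK : (0 : ℝ) < K := by exact_mod_cast hpos.trans_le hn
  have hnK : (n : ℝ) ≤ K := by exact_mod_cast hn
  have hinj : (Finset.univ.filter (fun X : Fin n → α => Function.Injective X)).card =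
      K.descFactorial n := by
    rw [← Fintype.card_subtype, Fintype.card_congr (Equiv.subtypeInjectiveEquivEmbedding _ _),
      Fintype.card_embedding_eq, Fintype.card_fin]
  have hsplit := Finset.card_filter_add_card_filter_not
    (s := (Finset.univ : Finset (Fin n → α))) (fun X => Function.Injective X)
  rw [hinj, Finset.card_univ, Fintype.card_fun, Fintype.card_fin] at hsplit
  have hsplit' : (K.descFactorial n : ℝ) +
      ((Finset.univ.filter (fun X : Fin n → α => ¬ Function.Injective X)).card : ℝ) =
      (K : ℝ) ^ n := by exact_mod_cast hsplit
  have hdesc : ((K : ℝ) + 1 - n) ^ n ≤ K.descFactorial n := by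
    have := Nat.pow_sub_le_descFactorial K n
    have h' : (((K + 1 - n : ℕ) : ℝ)) ^ n ≤ K.descFactorial n := by exact_mod_cast this
    rwa [Nat.cast_sub (by omega), Nat.cast_add, Nat.cast_one] at h'
  have hbern : 1 + (n : ℝ) * (-(n / K)) ≤ (1 + -(n / K : ℝ)) ^ n := by
    refine one_add_mul_le_pow ?_ n
    have : (n : ℝ) / K ≤ 1 := (div_le_one hK).2 hnK
    linarith
  have hlow : (K : ℝ) ^ n * (1 + (n : ℝ) * (-(n / K))) ≤ K.descFactorial n := by
    calc _ ≤ (K : ℝ) ^ n * (1 + -(n / K : ℝ)) ^ n := by gcongr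
      _ = ((K : ℝ) - n) ^ n := by rw [← mul_pow]; congr 1; field_simp; ring
      _ ≤ ((K : ℝ) + 1 - n) ^ n := by
        have : (0 : ℝ) ≤ K - n := by linarith
        gcongr
        linarith
      _ ≤ _ := hdesc
  have : (n : ℝ) ^ 2 / K * (K : ℝ) ^ n = (K : ℝ) ^ n - (K : ℝ) ^ n * (1 + (n : ℝ) * (-(n / K))) := by
    ring
  linarith

/-- For every real `a > 0` there exist reals `β > 0` and `c > 0` and an integer `n₀` such
that for every integer `n ≥ n₀` the following holds: if each of `n` balls independently
chooses a bin uniformly at random from `{1,…,⌈n / ln n⌉}` and, independently, a label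
uniformly at random from `{1,…,⌈n ^ β⌉}` (the outcome is a function
`X : Fin n → Fin ⌈n/ln n⌉₊ × Fin ⌈n^β⌉₊` distributed according to the product of the
uniform distributions), then with probability at least `1 - n ^ (-a)` both
(i) every bin contains at most `c * ln n` balls, and
(ii) no two distinct balls have both the same bin and the same label
(i.e. `X` is injective). -/
theorem bins_load_and_no_labeled_collision (a : ℝ) (ha : 0 < a) :
    ∃ β c : ℝ, 0 < β ∧ 0 < c ∧ ∃ n₀ : ℕ, ∀ n : ℕ, n₀ ≤ n →
      1 - (n : ℝ) ^ (-a) ≤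
        ((Finset.univ.filter
            (fun X : Fin n → Fin ⌈(n : ℝ) / Real.log n⌉₊ × Fin ⌈(n : ℝ) ^ β⌉₊ =>
              (∀ b : Fin ⌈(n : ℝ) / Real.log n⌉₊,
                  ((Finset.univ.filter (fun i => (X i).1 = b)).card : ℝ) ≤ c * Real.log n) ∧
              Function.Injective X)).card : ℝ)
          / ((⌈(n : ℝ) / Real.log n⌉₊ : ℝ) * (⌈(n : ℝ) ^ β⌉₊ : ℝ)) ^ n := by
  refine ⟨a + 3, a + 4, by linarith, by linarith, 3, fun n hn => ?_⟩
  have hn3 : (3 : ℝ) ≤ n := by exact_mod_cast hn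
  have hn0 : (0 : ℝ) < n := by linarith
  have hlog : 1 ≤ Real.log n := by
    rw [Real.le_log_iff_exp_le hn0]
    linarith [Real.exp_one_lt_d9]
  have hmpos : 0 < ⌈(n : ℝ) / Real.log n⌉₊ := Nat.ceil_pos.2 (by positivity)
  have hmle : ⌈(n : ℝ) / Real.log n⌉₊ ≤ n := Nat.ceil_le.2 (div_le_self hn0.le hlog)
  have hnm : (n : ℝ) ≤ ⌈(n : ℝ) / Real.log n⌉₊ * Real.log n :=
    (div_le_iff₀ (by linarith)).1 (Nat.le_ceil _)
  have hl : (n : ℝ) ^ (a + 3) ≤ ⌈(n : ℝ) ^ (a + 3)⌉₊ := Nat.le_ceil _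
  generalize ⌈(n : ℝ) / Real.log n⌉₊ = m at *
  generalize ⌈(n : ℝ) ^ (a + 3)⌉₊ = l at *
  have hm1 : (1 : ℝ) ≤ m := by exact_mod_cast hmpos
  have hmn : (m : ℝ) ≤ n := by exact_mod_cast hmle
  have hnl : (n : ℝ) ≤ l := by
    refine le_trans ?_ hl
    simpa using Real.rpow_le_rpow_of_exponent_le (by linarith : (1 : ℝ) ≤ n)
      (by linarith : (1 : ℝ) ≤ a + 3)
  have hl0 : (0 : ℝ) < l := by linarith
  have hlm : (l : ℝ) ≤ m * l := le_mul_of_one_le_left hl0.le hm1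
  have hN : 0 < ((m : ℝ) * l) ^ n := by positivity
  set N := ((m : ℝ) * l) ^ n
  set good := Finset.univ.filter (fun X : Fin n → Fin m × Fin l =>
    (∀ b : Fin m, ((Finset.univ.filter (fun i => (X i).1 = b)).card : ℝ) ≤
      (a + 4) * Real.log n) ∧ Function.Injective X) with hgood
  set heavy : Fin m → Finset (Fin n → Fin m × Fin l) := fun b =>
    Finset.univ.filter (fun X : Fin n → Fin m × Fin l =>
      (a + 4) * Real.log n < ((Finset.univ.filter (fun i => (X i).1 = b)).card : ℝ)) with hheavy
  set coll := Finset.univ.filter (fun X : Fin n → Fin m × Fin l => ¬ Function.Injective X)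
    with hcoll
  have hheavy_card : ((Finset.univ.biUnion heavy).card : ℝ) ≤ (n : ℝ) ^ (-a - 1) * N := by
    calc ((Finset.univ.biUnion heavy).card : ℝ) ≤ ∑ b, ((heavy b).card : ℝ) := by
          exact_mod_cast Finset.card_biUnion_le
      _ ≤ ∑ _b : Fin m, (n : ℝ) ^ (-a - 2) * N := by
          refine Finset.sum_le_sum fun b _ => ?_
          refine (card_load_gt_le hmpos hnm b (a + 4)).trans_eq ?_
          rw [Real.rpow_def_of_pos hn0]
          congr 2
          ring
      _ = m * ((n : ℝ) ^ (-a - 2) * N) := by simp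
      _ ≤ n * ((n : ℝ) ^ (-a - 2) * N) := by gcongr
      _ = (n : ℝ) ^ (-a - 1) * N := by
          rw [← mul_assoc, show -a - 1 = 1 + (-a - 2) by ring, Real.rpow_add hn0, Real.rpow_one]
  have hcoll_card : (coll.card : ℝ) ≤ (n : ℝ) ^ (-a - 1) * N := by
    have hK : (Fintype.card (Fin m × Fin l) : ℝ) = m * l := by simp
    have h := card_not_injective_le (α := Fin m × Fin l) (n := n) (by
      have : (n : ℝ) ≤ Fintype.card (Fin m × Fin l) := by rw [hK]; linarith
      exact_mod_cast this)
    rw [hK] at h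
    refine h.trans ?_
    gcongr
    calc (n : ℝ) ^ 2 / (m * l) ≤ (n : ℝ) ^ 2 / (n : ℝ) ^ (a + 3) := by
          gcongr
          linarith
      _ = (n : ℝ) ^ (-a - 1) := by
          rw [← Real.rpow_natCast, ← Real.rpow_sub hn0]
          congr 1
          push_cast
          ring
  have hcover : (Finset.univ : Finset (Fin n → Fin m × Fin l)) ⊆
      good ∪ (Finset.univ.biUnion heavy ∪ coll) := by
    intro X _
    simp only [hgood, hheavy, hcoll, Finset.mem_union, Finset.mem_biUnion, Finset.mem_filter,
      Finset.mem_univ, true_and, ← not_le, ← not_forall]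
    tauto
  have htotal : N ≤ good.card + ((Finset.univ.biUnion heavy).card + coll.card) := by
    have h := (Finset.card_le_card hcover).trans ((Finset.card_union_le _ _).trans
      (Nat.add_le_add_left (Finset.card_union_le _ _) _))
    rw [Finset.card_univ, Fintype.card_fun, Fintype.card_prod, Fintype.card_fin, Fintype.card_fin,
      Fintype.card_fin] at h
    simp only [N]
    exact_mod_cast h
  have htail : 2 * (n : ℝ) ^ (-a - 1) ≤ (n : ℝ) ^ (-a) := by
    rw [show -a = 1 + (-a - 1) by ring, Real.rpow_add hn0, Real.rpow_one,
      show 1 + (-a - 1) - 1 = -a - 1 by ring]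
    gcongr
    linarith
  rw [le_div_iff₀ hN]
  linarith [mul_le_mul_of_nonneg_right htail hN.le]
end

section
/- Let δ = ln 2 / (2(2 + ln 2)). For every real β > 4/3 and all integers n ≥ 1 and k ≥ 2 with 2^{k/β} ≤ δ·n: if n balls are thrown independently and uniformly at random into 2^k bins, then the probability that at most 2^{k/β} bins are occupied is at most exp(−n·(ln 2)/4). -/
open scoped Classical

/-- At most `C(N, m) m ^ n` functions `ι → α`, with `n = |ι|` and `N = |α|`, have an image
contained in a set of at most `m` points. -/
theorem card_filter_card_image_le {ι α : Type*} [Fintype ι] [DecidableEq ι] [Fintype α]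
    [DecidableEq α] {m : ℕ} (hm : m ≤ Fintype.card α) :
    (Finset.univ.filter (fun X : ι → α => (Finset.univ.image X).card ≤ m)).card
      ≤ (Fintype.card α).choose m * m ^ Fintype.card ι := by
  have hsub : Finset.univ.filter (fun X : ι → α => (Finset.univ.image X).card ≤ m) ⊆
      (Finset.univ.powersetCard m).biUnion
        (fun S : Finset α => Fintype.piFinset fun _ : ι => S) := by
    intro X hX
    obtain ⟨S, hS, hcard⟩ :=
      Finset.exists_superset_card_eq (Finset.mem_filter.1 hX).2 hm
    refine Finset.mem_biUnion.2 ⟨S, by simp [Finset.mem_powersetCard, hcard], ?_⟩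
    exact Fintype.mem_piFinset.2 fun i =>
      hS (Finset.mem_image_of_mem X (Finset.mem_univ i))
  refine (Finset.card_le_card hsub).trans ?_
  refine (Finset.card_biUnion_le_card_mul _ _ (m ^ Fintype.card ι) fun S hS => ?_).trans ?_
  · simp [Fintype.card_piFinset, (Finset.mem_powersetCard.1 hS).2]
  · simp [Finset.card_powersetCard]

/-- The binomial bound `C(N, m) (m / N) ^ m ≤ e ^ m`. -/
theorem choose_mul_pow_le_exp_mul_pow (N m : ℕ) :
    (N.choose m : ℝ) * (m : ℝ) ^ m ≤ Real.exp m * (N : ℝ) ^ m := by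
  calc (N.choose m : ℝ) * (m : ℝ) ^ m
      ≤ ((N : ℝ) ^ m / m.factorial) * (m : ℝ) ^ m := by
        gcongr
        exact Nat.choose_le_pow_div m N
    _ = ((m : ℝ) ^ m / m.factorial) * (N : ℝ) ^ m := by ring
    _ ≤ Real.exp m * (N : ℝ) ^ m := by
        gcongr
        exact Real.pow_div_factorial_le_exp m (Nat.cast_nonneg m) m

/-- If `m ≤ n`, the proportion of functions from `n` points to `N` points whose image has at most
`m` points is at most `e ^ m (m / N) ^ (n - m)`. -/
theorem choose_mul_pow_div_le {N m n : ℕ} (hN : 0 < N) (hmn : m ≤ n) :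
    ((N.choose m * m ^ n : ℕ) : ℝ) / (N : ℝ) ^ n
      ≤ Real.exp m * ((m : ℝ) / N) ^ (n - m) := by
  obtain ⟨r, rfl⟩ := Nat.exists_eq_add_of_le hmn
  have hN' : (0 : ℝ) < N := Nat.cast_pos.2 hN
  rw [Nat.add_sub_cancel_left, div_le_iff₀ (by positivity)]
  calc ((N.choose m * m ^ (m + r) : ℕ) : ℝ)
      = ((N.choose m : ℝ) * (m : ℝ) ^ m) * (m : ℝ) ^ r := by push_cast; ring
    _ ≤ (Real.exp m * (N : ℝ) ^ m) * (m : ℝ) ^ r :=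
        mul_le_mul_of_nonneg_right (choose_mul_pow_le_exp_mul_pow N m) (by positivity)
    _ = Real.exp m * ((m : ℝ) / N) ^ r * (N : ℝ) ^ (m + r) := by
        rw [div_pow, pow_add]
        field_simp

/-- Let `δ = ln 2 / (2 (2 + ln 2))`. For every real `β > 4/3` and all integers `n ≥ 1`
and `k ≥ 2` with `2 ^ (k/β) ≤ δ·n`: if `n` balls are thrown independently and uniformly
at random into `2^k` bins (the outcome is `X : Fin n → Fin (2^k)` distributed according
to the product of `n` copies of the uniform distribution), then the probability that at
most `2 ^ (k/β)` bins are occupied (the image of `X` has cardinality at most `2 ^ (k/β)`)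
is at most `exp (-n · (ln 2) / 4)`. -/
theorem few_occupied_bins_prob (β : ℝ) (hβ : 4 / 3 < β) (n k : ℕ) (hn : 1 ≤ n)
    (hk : 2 ≤ k)
    (h : (2 : ℝ) ^ ((k : ℝ) / β) ≤ (Real.log 2 / (2 * (2 + Real.log 2))) * n) :
    ((Finset.univ.filter (fun X : Fin n → Fin (2 ^ k) =>
        ((Finset.univ.image X).card : ℝ) ≤ (2 : ℝ) ^ ((k : ℝ) / β))).card : ℝ)
        / ((2 : ℝ) ^ k) ^ n
      ≤ Real.exp (-(n : ℝ) * Real.log 2 / 4) := by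
  set M : ℝ := (2 : ℝ) ^ ((k : ℝ) / β) with hM
  have hl : 0 < Real.log 2 := Real.log_pos one_lt_two
  have hM0 : 0 < M := by positivity
  have hn0 : (0 : ℝ) < n := by exact_mod_cast hn
  have hk2 : (2 : ℝ) ≤ k := by exact_mod_cast hk
  have hMn : M * (2 + Real.log 2) ≤ Real.log 2 / 2 * n := by
    calc M * (2 + Real.log 2)
        ≤ Real.log 2 / (2 * (2 + Real.log 2)) * n * (2 + Real.log 2) := by gcongr
      _ = Real.log 2 / 2 * n := by
          have : 2 + Real.log 2 ≠ 0 := by positivity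
          field_simp
  have hratio : M / 2 ^ k ≤ Real.exp (-(Real.log 2 / 2)) := by
    have hkβ : (k : ℝ) / β ≤ k * (3 / 4) := by
      rw [div_le_iff₀ (by linarith)]
      nlinarith
    rw [hM, ← Real.rpow_natCast, ← Real.rpow_sub two_pos, Real.rpow_def_of_pos two_pos]
    gcongr
    nlinarith
  obtain ⟨m, hm⟩ : ∃ m, m = ⌊M⌋₊ := ⟨_, rfl⟩
  have hmM : (m : ℝ) ≤ M := hm ▸ Nat.floor_le hM0.le
  have hmn : m ≤ n := by
    have : (m : ℝ) ≤ n := by nlinarith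
    exact_mod_cast this
  have hmN : m ≤ 2 ^ k := by
    have h1 : M / 2 ^ k ≤ 1 :=
      hratio.trans (Real.exp_le_one_iff.2 (by linarith))
    rw [div_le_one (by positivity)] at h1
    exact_mod_cast hmM.trans h1
  have hcount : (Finset.univ.filter (fun X : Fin n → Fin (2 ^ k) =>
      ((Finset.univ.image X).card : ℝ) ≤ M)).card ≤ (2 ^ k).choose m * m ^ n := by
    have hc := card_filter_card_image_le (ι := Fin n) (α := Fin (2 ^ k)) (m := m)
      (by simpa using hmN)
    rw [Fintype.card_fin, Fintype.card_fin] at hc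
    refine (Finset.card_le_card fun X hX => ?_).trans hc
    rw [Finset.mem_filter] at hX ⊢
    exact ⟨hX.1, hm ▸ Nat.le_floor hX.2⟩
  calc _ ≤ (((2 ^ k).choose m * m ^ n : ℕ) : ℝ) / ((2 : ℝ) ^ k) ^ n := by
        gcongr
    _ ≤ Real.exp m * ((m : ℝ) / 2 ^ k) ^ (n - m) := by
        simpa using choose_mul_pow_div_le (N := 2 ^ k) (by positivity) hmn
    _ ≤ Real.exp m * Real.exp (-(Real.log 2 / 2)) ^ (n - m) := by
        gcongr
        exact (div_le_div_of_nonneg_right hmM (by positivity)).trans hratio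
    _ = Real.exp (m + ((n : ℝ) - m) * (-(Real.log 2 / 2))) := by
        rw [← Real.exp_nat_mul, ← Real.exp_add, Nat.cast_sub hmn]
    _ ≤ Real.exp (-(n : ℝ) * Real.log 2 / 4) := by
        gcongr
        nlinarith
end

section
/- For every real a > 0 and every real β > 4a + 7 there exists an integer n₀ such that for all integers n ≥ n₀ and all integers k with k > (1/2)·lg n the following holds: if each of n balls independently chooses a bin uniformly at random from {1,…,⌊2^k/(βk)⌋} and, independently, a label uniformly at random from {1,…,⌊2^{βk}⌋}, then the probability that some two distinct balls have both the same bin and the same label is smaller than n^{−a}. -/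
open scoped Classical

/-- Functions agreeing at two fixed distinct points make up a `1 / card α` share of all functions. -/
theorem card_filter_apply_eq_mul_card_le {ι α : Type*} [Fintype ι] [Fintype α] [DecidableEq ι]
    {i j : ι} (hij : i ≠ j) :
    (Finset.univ.filter (fun X : ι → α => X i = X j)).card * Fintype.card α
      ≤ Fintype.card α ^ Fintype.card ι := by
  rw [← Finset.card_univ (α := α), ← Finset.card_product, Finset.card_univ,
    ← Fintype.card_fun, ← Finset.card_univ]
  refine Finset.card_le_card_of_injOn (fun p => Function.update p.1 j p.2)
    (fun _ _ => Finset.mem_coe.2 (Finset.mem_univ _)) ?_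
  rintro ⟨X, c⟩ hX ⟨Y, d⟩ hY h
  simp only [Finset.coe_product, Set.mem_prod, Finset.mem_coe, Finset.mem_filter,
    Finset.mem_univ, true_and, and_true] at hX hY
  have key : ∀ l, Function.update X j c l = Function.update Y j d l := congrFun h
  have hcd : c = d := by simpa using key j
  have hne : ∀ l, l ≠ j → X l = Y l := fun l hl => by simpa [hl] using key l
  refine Prod.ext (funext fun l => ?_) hcd
  by_cases hl : l = j
  · subst hl
    exact hX.symm.trans ((hne i hij).trans hY)
  · exact hne l hl

/-- Union bound over pairs for the number of non-injective functions. -/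
theorem card_filter_not_injective_mul_card_le {ι α : Type*} [Fintype ι] [Fintype α] [DecidableEq ι]
    [DecidablePred fun X : ι → α => ¬ Function.Injective X] :
    (Finset.univ.filter (fun X : ι → α => ¬ Function.Injective X)).card * Fintype.card α
      ≤ Fintype.card ι ^ 2 * Fintype.card α ^ Fintype.card ι := by
  have hsub : Finset.univ.filter (fun X : ι → α => ¬ Function.Injective X) ⊆
      (Finset.univ.filter (fun p : ι × ι => p.1 ≠ p.2)).biUnion
        (fun p => Finset.univ.filter (fun X : ι → α => X p.1 = X p.2)) := by
    intro X hX
    obtain ⟨i, j, h, hij⟩ := Function.not_injective_iff.1 (Finset.mem_filter.1 hX).2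
    simp only [Finset.mem_biUnion, Finset.mem_filter, Finset.mem_univ, true_and]
    exact ⟨(i, j), hij, h⟩
  calc _ ≤ (∑ p ∈ Finset.univ.filter (fun p : ι × ι => p.1 ≠ p.2),
        (Finset.univ.filter (fun X : ι → α => X p.1 = X p.2)).card) * Fintype.card α :=
        Nat.mul_le_mul_right _ ((Finset.card_le_card hsub).trans Finset.card_biUnion_le)
    _ ≤ ∑ p ∈ Finset.univ.filter (fun p : ι × ι => p.1 ≠ p.2),
        Fintype.card α ^ Fintype.card ι := by
        rw [Finset.sum_mul]
        exact Finset.sum_le_sum fun p hp =>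
          card_filter_apply_eq_mul_card_le (Finset.mem_filter.1 hp).2
    _ ≤ _ := by
        rw [Finset.sum_const, smul_eq_mul]
        refine Nat.mul_le_mul_right _ ((Finset.card_filter_le _ _).trans ?_)
        simp [sq]

theorem eventually_const_mul_le_two_rpow (c r : ℝ) (hr : 0 < r) :
    ∀ᶠ k : ℕ in Filter.atTop, c * k ≤ (2 : ℝ) ^ (r * k) := by
  have h := (isLittleO_pow_exp_pos_mul_atTop 1
    (mul_pos hr (Real.log_pos one_lt_two))).const_mul_left c
  have h' := (h.comp_tendsto tendsto_natCast_atTop_atTop).bound (c := 1) one_pos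
  filter_upwards [h'] with k hk
  simp only [Function.comp_apply, pow_one, one_mul, Real.norm_eq_abs, Real.abs_exp] at hk
  rw [Real.rpow_def_of_pos two_pos]
  refine (le_abs_self _).trans (hk.trans_eq ?_)
  congr 1
  ring



/-- For every real `a > 0` and every real `β > 4a + 7` there exists an integer `n₀` such
that for all integers `n ≥ n₀` and all integers `k` with `k > (1/2) · lg n` the
following holds: if each of `n` balls independently chooses a bin uniformly at random
from `{1,…,⌊2^k/(βk)⌋}` and, independently, a label uniformly at random from
`{1,…,⌊2^(βk)⌋}` (the outcome is `X : Fin n → Fin ⌊2^k/(βk)⌋₊ × Fin ⌊2^(βk)⌋₊`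
distributed according to the product of the uniform distributions), then the probability
that some two distinct balls have both the same bin and the same label (i.e. `X` is not
injective) is smaller than `n ^ (-a)`. -/
theorem label_collision_unlikely (a β : ℝ) (ha : 0 < a) (hβ : 4 * a + 7 < β) :
    ∃ n₀ : ℕ, ∀ n : ℕ, n₀ ≤ n → ∀ k : ℕ, (1 / 2 : ℝ) * Real.logb 2 n < (k : ℝ) →
      ((Finset.univ.filter
          (fun X : Fin n → Fin ⌊(2 : ℝ) ^ k / (β * k)⌋₊ × Fin ⌊(2 : ℝ) ^ (β * k)⌋₊ =>
            ¬ Function.Injective X)).card : ℝ)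
        / ((⌊(2 : ℝ) ^ k / (β * k)⌋₊ : ℝ) * (⌊(2 : ℝ) ^ (β * k)⌋₊ : ℝ)) ^ n
      < (n : ℝ) ^ (-a) := by
  have hβ0 : 0 < β := by linarith
  obtain ⟨K, hK⟩ := Filter.eventually_atTop.1
    ((eventually_const_mul_le_two_rpow β 1 one_pos).and
      (eventually_const_mul_le_two_rpow (4 * β) (β / 2) (by linarith)))
  refine ⟨4 ^ K, fun n hn k hk => ?_⟩
  have hn0 : (0 : ℝ) < n := by
    exact_mod_cast (pow_pos (by norm_num) K).trans_le hn
  have hn4 : (2 : ℝ) ^ ((2 * K : ℕ) : ℝ) ≤ n := by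
    rw [Real.rpow_natCast, pow_mul]
    norm_num
    exact_mod_cast hn
  have hlog := (Real.le_logb_iff_rpow_le one_lt_two hn0).2 hn4
  push_cast at hlog
  have hKk : (K : ℝ) < k := by linarith
  have hk0 : (0 : ℝ) < k := (Nat.cast_nonneg K).trans_lt hKk
  obtain ⟨h₁, h₂⟩ := hK k (by exact_mod_cast hKk.le)
  rw [one_mul, Real.rpow_natCast] at h₁
  have hβk : 0 < β * k := mul_pos hβ0 hk0
  have hM := Nat.div_two_lt_floor ((one_le_div hβk).2 h₁)
  have hN := Nat.div_two_lt_floor (Real.one_le_rpow one_le_two hβk.le)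
  set M := ⌊(2 : ℝ) ^ k / (β * k)⌋₊
  set N := ⌊(2 : ℝ) ^ (β * k)⌋₊
  have hM0 : (0 : ℝ) < M := lt_trans (by positivity) hM
  have hN0 : (0 : ℝ) < N := lt_trans (by positivity) hN
  have hcount := card_filter_not_injective_mul_card_le (ι := Fin n) (α := Fin M × Fin N)
  simp only [Fintype.card_prod, Fintype.card_fin] at hcount
  have hcount' := (Nat.cast_le (α := ℝ)).2 hcount
  push_cast at hcount'
  have hMN : (2 : ℝ) ^ (2 * k * (2 + a)) < M * N :=
    calc (2 : ℝ) ^ (2 * k * (2 + a)) ≤ (2 : ℝ) ^ (k + (β * k - β / 2 * k)) := by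
          apply Real.rpow_le_rpow_of_exponent_le one_le_two
          nlinarith
      _ = 2 ^ k * (2 ^ (β * k) / 2 ^ (β / 2 * k)) := by
          rw [Real.rpow_add two_pos, Real.rpow_sub two_pos, Real.rpow_natCast]
      _ ≤ 2 ^ k * (2 ^ (β * k) / (4 * β * k)) := by
          gcongr
      _ = (2 ^ k / (β * k) / 2) * (2 ^ (β * k) / 2) := by
          field_simp
          norm_num
      _ < M * N := mul_lt_mul'' hM hN (by positivity) (by positivity)
  have hna : (n : ℝ) ^ (2 + a) < M * N := by
    refine lt_trans ?_ hMN
    rw [Real.rpow_mul zero_le_two]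
    refine Real.rpow_lt_rpow hn0.le ?_ (by linarith)
    exact (Real.logb_lt_iff_lt_rpow one_lt_two hn0).1 (by linarith)
  calc _ ≤ (n : ℝ) ^ 2 / (M * N) := by
        rw [div_le_div_iff₀ (by positivity) (by positivity)]
        exact hcount'
    _ < (n : ℝ) ^ (-a) := by
        rw [div_lt_iff₀ (by positivity), Real.rpow_neg hn0.le, inv_mul_eq_div,
          lt_div_iff₀ (by positivity), ← Real.rpow_natCast, Nat.cast_two, ← Real.rpow_add hn0]
        exact hna
end

section
/- For every real a > 0 there exist a real β₀ > 0 and an integer n₀ such that for all reals β ≥ β₀ and all integers n ≥ n₀ the following holds: set k = 1 + ⌈lg n⌉ and N = ⌈2n/(βk)⌉; if n balls are thrown independently and uniformly at random into N bins, then the probability that some bin receives more than βk balls is at most n^{−a}. -/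
open scoped Classical

/-- Generating function of the load of a fixed bin, evaluated at `2`. -/
theorem sum_two_pow_load (n N : ℕ) (b : Fin N) :
    ∑ X : Fin n → Fin N, (2 : ℝ) ^ (Finset.univ.filter (fun i => X i = b)).card
      = ((N : ℝ) + 1) ^ n := by
  have h1 : ∀ X : Fin n → Fin N,
      (2 : ℝ) ^ (Finset.univ.filter (fun i => X i = b)).card
        = ∏ i, (if X i = b then (2 : ℝ) else 1) := by
    intro X
    rw [Finset.prod_ite]
    simp
  have h2 : ∑ c : Fin N, (if c = b then (2 : ℝ) else 1) = N + 1 := by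
    have h3 : ∀ c : Fin N, (if c = b then (2 : ℝ) else 1) = 1 + if c = b then 1 else 0 := by
      intro c
      split_ifs <;> norm_num
    simp [h3, Finset.sum_add_distrib]
  simp_rw [h1]
  have h4 := Finset.sum_prod_piFinset (ι := Fin n) (Finset.univ : Finset (Fin N))
    (fun _ c => if c = b then (2 : ℝ) else 1)
  rw [Fintype.piFinset_univ] at h4
  rw [h4, h2]
  simp

/-- Chernoff bound, in counting form, for the load of a fixed bin. -/
theorem card_load_gt_mul_le (n N : ℕ) (b : Fin N) (t : ℝ) :
    ((Finset.univ.filter (fun X : Fin n → Fin N =>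
        t < ((Finset.univ.filter (fun i => X i = b)).card : ℝ))).card : ℝ) * (2 : ℝ) ^ t
      ≤ ((N : ℝ) + 1) ^ n := by
  rw [← sum_two_pow_load n N b, ← nsmul_eq_mul]
  refine (Finset.card_nsmul_le_sum _ (fun X : Fin n → Fin N =>
    (2 : ℝ) ^ (Finset.univ.filter (fun i => X i = b)).card) _ ?_).trans ?_
  · intro X hX
    rw [← Real.rpow_natCast]
    exact Real.rpow_le_rpow_of_exponent_le (by norm_num) (Finset.mem_filter.mp hX).2.le
  · exact Finset.sum_le_sum_of_subset_of_nonneg (Finset.filter_subset _ _)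
      (fun _ _ _ => by positivity)

/-- Union bound over the bins. -/
theorem card_exists_load_gt_mul_le (n N : ℕ) (t : ℝ) :
    ((Finset.univ.filter (fun X : Fin n → Fin N =>
        ∃ b : Fin N, t < ((Finset.univ.filter (fun i => X i = b)).card : ℝ))).card : ℝ)
        * (2 : ℝ) ^ t
      ≤ N * ((N : ℝ) + 1) ^ n := by
  have hsub : (Finset.univ.filter (fun X : Fin n → Fin N =>
        ∃ b : Fin N, t < ((Finset.univ.filter (fun i => X i = b)).card : ℝ)))
      ⊆ Finset.univ.biUnion (fun b : Fin N => Finset.univ.filter (fun X : Fin n → Fin N =>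
        t < ((Finset.univ.filter (fun i => X i = b)).card : ℝ))) := by
    intro X hX
    simpa using hX
  have hcard : ((Finset.univ.filter (fun X : Fin n → Fin N =>
        ∃ b : Fin N, t < ((Finset.univ.filter (fun i => X i = b)).card : ℝ))).card : ℝ)
      ≤ ∑ b : Fin N, ((Finset.univ.filter (fun X : Fin n → Fin N =>
        t < ((Finset.univ.filter (fun i => X i = b)).card : ℝ))).card : ℝ) := by
    exact_mod_cast (Finset.card_le_card hsub).trans Finset.card_biUnion_le
  calc _ ≤ _ := mul_le_mul_of_nonneg_right hcard (by positivity)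
    _ ≤ ∑ _b : Fin N, ((N : ℝ) + 1) ^ n := by
        rw [Finset.sum_mul]
        exact Finset.sum_le_sum fun b _ => card_load_gt_mul_le n N b t
    _ = _ := by simp

/-- For every real `a > 0` there exist a real `β₀ > 0` and an integer `n₀` such that for
all reals `β ≥ β₀` and all integers `n ≥ n₀` the following holds: set
`k = 1 + ⌈lg n⌉` and `N = ⌈2n/(βk)⌉`; if `n` balls are thrown independently and
uniformly at random into `N` bins (the outcome is `X : Fin n → Fin N` distributed
according to the product of `n` copies of the uniform distribution), then the
probability that some bin receives more than `βk` balls is at most `n ^ (-a)`. -/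
theorem max_load_bound (a : ℝ) (ha : 0 < a) :
    ∃ β₀ : ℝ, 0 < β₀ ∧ ∃ n₀ : ℕ, ∀ β : ℝ, β₀ ≤ β → ∀ n : ℕ, n₀ ≤ n →
      ∀ k : ℕ, k = 1 + ⌈Real.logb 2 n⌉₊ →
      ∀ N : ℕ, N = ⌈2 * (n : ℝ) / (β * k)⌉₊ →
        ((Finset.univ.filter (fun X : Fin n → Fin N =>
            ∃ b : Fin N,
              β * (k : ℝ) < ((Finset.univ.filter (fun i => X i = b)).card : ℝ))).card : ℝ)
          / (N : ℝ) ^ n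
        ≤ (n : ℝ) ^ (-a) := by
  refine ⟨6 * (a + 1) + 2, by linarith, 1, ?_⟩
  intro β hβ n hn k hk N hN
  have hn1 : (1 : ℝ) ≤ n := by exact_mod_cast hn
  have hn0 : (0 : ℝ) < n := by linarith
  have hβ0 : 0 < β := by linarith
  have hk1 : (1 : ℝ) ≤ k := by
    rw [hk]
    push_cast
    linarith [(Nat.cast_nonneg ⌈Real.logb 2 n⌉₊ : (0 : ℝ) ≤ _)]
  have hlogn : 0 ≤ Real.log n := Real.log_nonneg hn1
  have hl2 := Real.log_two_gt_d9
  have hl2' := Real.log_two_lt_d9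
  have hklog : Real.log n ≤ k := by
    have h1 : Real.logb 2 n ≤ ⌈Real.logb 2 n⌉₊ := Nat.le_ceil _
    have h2 : Real.log n ≤ Real.logb 2 n := by
      rw [Real.logb, le_div_iff₀ (by linarith)]
      nlinarith
    rw [hk]
    push_cast
    linarith
  have hβk : 0 < β * k := by positivity
  have hNpos : 0 < N := by
    rw [hN]
    exact Nat.ceil_pos.mpr (by positivity)
  have hN0 : (0 : ℝ) < N := by exact_mod_cast hNpos
  have hNge : 2 * (n : ℝ) / (β * k) ≤ N := by
    rw [hN]
    exact Nat.le_ceil _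
  have hNn : (N : ℝ) ≤ n := by
    have : N ≤ n := by
      rw [hN]
      refine Nat.ceil_le.mpr ?_
      rw [div_le_iff₀ hβk]
      have : 2 ≤ β * k := by nlinarith
      nlinarith
    exact_mod_cast this
  have hmean : (n : ℝ) / N ≤ β * k / 2 := by
    rw [div_le_iff₀ hβk] at hNge
    rw [div_le_iff₀ hN0]
    linarith
  have hpow : ((N : ℝ) + 1) ^ n ≤ Real.exp (β * k / 2) * (N : ℝ) ^ n := by
    have h1 : ((N : ℝ) + 1) = (1 / N + 1) * N := by field_simp; ring
    rw [h1, mul_pow]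
    refine mul_le_mul_of_nonneg_right ?_ (by positivity)
    calc (1 / (N : ℝ) + 1) ^ n ≤ Real.exp (1 / N) ^ n :=
          pow_le_pow_left₀ (by positivity) (Real.add_one_le_exp _) n
      _ = Real.exp (n / N) := by
          rw [← Real.exp_nat_mul]
          congr 1
          ring
      _ ≤ _ := Real.exp_le_exp.mpr hmean
  have hexp : (n : ℝ) * Real.exp (β * k / 2) ≤ (n : ℝ) ^ (-a) * (2 : ℝ) ^ (β * k) := by
    rw [Real.rpow_def_of_pos hn0, Real.rpow_def_of_pos (by norm_num : (0 : ℝ) < 2),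
      ← Real.exp_add]
    nth_rewrite 1 [← Real.exp_log hn0]
    rw [← Real.exp_add]
    refine Real.exp_le_exp.mpr ?_
    have h1 : 6 * (a + 1) * Real.log n ≤ β * k :=
      mul_le_mul (by linarith) hklog hlogn hβ0.le
    nlinarith
  rw [div_le_iff₀ (by positivity)]
  refine le_of_mul_le_mul_right ?_ (by positivity : (0 : ℝ) < (2 : ℝ) ^ (β * k))
  calc _ ≤ (N : ℝ) * ((N : ℝ) + 1) ^ n := card_exists_load_gt_mul_le n N (β * k)
    _ ≤ n * (Real.exp (β * k / 2) * (N : ℝ) ^ n) :=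
        mul_le_mul hNn hpow (by positivity) hn0.le
    _ = (n * Real.exp (β * k / 2)) * (N : ℝ) ^ n := by ring
    _ ≤ ((n : ℝ) ^ (-a) * (2 : ℝ) ^ (β * k)) * (N : ℝ) ^ n :=
        mul_le_mul_of_nonneg_right hexp (by positivity)
    _ = _ := by ring
end
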